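/- arXiv:1909.03945 — 2 statements merged into one kernel-verified Lean document; each statement's English description precedes it below -/
import Mathlib

section
/- Let x₀ > 0, β ∈ ℂ, A, B ∈ ℂ, and let φ : [x₀, ∞) → ℂ be continuous and satisfy: for every N > 0, φ(x) − A x^β − B x^β ln x = O(x^{−N}) as x → ∞. Then there exists a function F, holomorphic on ℂ ∖ {−β−1}, such that: (i) for every λ with Re λ < −Re β − 1 the integral ∫_{x₀}^{∞} x^λ φ(x) dx converges absolutely and equals F(λ); (ii) the function λ ↦ F(λ) − B/(λ+β+1)² + A/(λ+β+1) extends holomorphically across −β−1, i.e. F has at −β−1 a pole of order at most 2 with singular part B(λ+β+1)^{−2} − A(λ+β+1)^{−1}; and (iii) the value at λ = −β−1 of this holomorphic extension (the finite part of F at the pole) equals lim_{R→∞} [ ∫_{x₀}^{R} x^{−β−1} φ(x) dx − A ln R − (B/2)(ln R)² ], which limit exists. (In finite-part notation: F.p. lim_{λ→−β−1} F(λ) = F.p. ∫_{x₀}^{∞} x^{−β−1} φ(x) dx.) -/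
open Filter Topology Asymptotics MeasureTheory

/-- The second-order Taylor quotient of the exponential at `0`, as an entire function. -/
lemma exists_entire_exp_second_quotient :
    ∃ e : ℂ → ℂ, Differentiable ℂ e ∧ e 0 = 1 / 2 ∧ ∀ w, Complex.exp w = 1 + w + w ^ 2 * e w := by
  have h1 : Differentiable ℂ (dslope Complex.exp 0) := by
    rw [← differentiableOn_univ, Complex.differentiableOn_dslope univ_mem]
    exact Complex.differentiable_exp.differentiableOn
  have h2 : Differentiable ℂ (dslope (dslope Complex.exp 0) 0) := by
    rw [← differentiableOn_univ, Complex.differentiableOn_dslope univ_mem]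
    exact h1.differentiableOn
  set e := dslope (dslope Complex.exp 0) 0 with he
  have hexp : ∀ w, Complex.exp w = 1 + w + w ^ 2 * e w := by
    intro w
    have a := sub_smul_dslope Complex.exp 0 w
    have b := sub_smul_dslope (dslope Complex.exp 0) 0 w
    have c : dslope Complex.exp 0 0 = 1 := by simp [dslope_same]
    rw [← he, c] at b
    simp only [smul_eq_mul, sub_zero, Complex.exp_zero] at a b
    linear_combination -a - w * b
  refine ⟨e, h2, ?_, hexp⟩
  have hd : ∀ w, w ≠ 0 → 1 + w * e w = 2 * e w + w * deriv e w := by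
    intro w hw
    have A1 : HasDerivAt (fun w => 1 + w + w ^ 2 * e w)
        (1 + (2 * w * e w + w ^ 2 * deriv e w)) w := by
      have := ((hasDerivAt_id w).const_add 1).add
        (((hasDerivAt_id w).pow 2).mul (h2 w).hasDerivAt)
      exact this.congr_deriv (by simp)
    have A2 : HasDerivAt (fun w => 1 + w + w ^ 2 * e w) (Complex.exp w) w := by
      rw [← funext hexp]
      exact Complex.hasDerivAt_exp w
    have A3 := A1.unique A2
    rw [hexp w] at A3
    apply mul_left_cancel₀ hw
    linear_combination -A3
  have hc : Continuous fun w => 1 + w * e w := by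
    have := h2.continuous
    fun_prop
  have hc' : Continuous fun w => 2 * e w + w * deriv e w := by
    have := h2.continuous
    have : Continuous (deriv e) := h2.contDiff.continuous_deriv (n := 1) le_rfl
    fun_prop
  have := Continuous.ext_on (dense_compl_singleton (0 : ℂ)) hc hc' (fun w hw => hd w hw)
  have := congrFun this 0
  simp only [zero_mul, add_zero] at this
  linear_combination -(1 / 2) * this

lemma continuousOn_ofReal_cpow_Ici {x₀ : ℝ} (hx₀ : 0 < x₀) (s : ℂ) :
    ContinuousOn (fun x : ℝ => (x : ℂ) ^ s) (Set.Ici x₀) := fun x hx =>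
  (Complex.continuousAt_ofReal_cpow_const x s
    (Or.inr (hx₀.trans_le hx).ne')).continuousWithinAt

lemma continuousOn_ofReal_log_Ici {x₀ : ℝ} (hx₀ : 0 < x₀) :
    ContinuousOn (fun x : ℝ => ((Real.log x : ℝ) : ℂ)) (Set.Ici x₀) :=
  Complex.continuous_ofReal.comp_continuousOn
    (Real.continuousOn_log.mono fun _ hx => (hx₀.trans_le hx).ne')

lemma isBigO_ofReal_cpow_atTop (s : ℂ) :
    (fun x : ℝ => (x : ℂ) ^ s) =O[atTop] fun x : ℝ => x ^ s.re := by
  refine IsBigO.of_bound 1 ?_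
  filter_upwards [eventually_gt_atTop 0] with x hx
  rw [Complex.norm_cpow_eq_rpow_re_of_pos hx, one_mul, Real.norm_of_nonneg (by positivity)]

lemma isBigO_ofReal_cpow_mul_log_atTop {s : ℂ} {a : ℝ} (ha : s.re < a) :
    (fun x : ℝ => (x : ℂ) ^ s * ((Real.log x : ℝ) : ℂ)) =O[atTop] fun x : ℝ => x ^ a := by
  have hlog : (fun x : ℝ => ((Real.log x : ℝ) : ℂ)) =O[atTop] fun x : ℝ => x ^ (a - s.re) := by
    rw [← isBigO_norm_left]
    simp only [Complex.norm_real]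
    exact (isLittleO_log_rpow_atTop (sub_pos.2 ha)).isBigO.norm_left
  refine ((isBigO_ofReal_cpow_atTop s).mul hlog).congr' EventuallyEq.rfl ?_
  filter_upwards [eventually_gt_atTop 0] with x hx
  rw [← Real.rpow_add hx]
  ring_nf

lemma ContinuousOn.integrableOn_Ici_of_isBigO_rpow {x₀ a : ℝ} {g : ℝ → ℂ}
    (hg : ContinuousOn g (Set.Ici x₀)) (ho : g =O[atTop] fun x : ℝ => x ^ a) (ha : a < -1) :
    IntegrableOn g (Set.Ici x₀) :=
  (hg.locallyIntegrableOn measurableSet_Ici).integrableOn_of_isBigO_atTop ho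
    (integrableAtFilter_rpow_atTop_iff.2 ha)

lemma integrableOn_Ici_cpow {x₀ : ℝ} (hx₀ : 0 < x₀) {s : ℂ} (hs : s.re < -1) :
    IntegrableOn (fun x : ℝ => (x : ℂ) ^ s) (Set.Ici x₀) :=
  (continuousOn_ofReal_cpow_Ici hx₀ s).integrableOn_Ici_of_isBigO_rpow
    (isBigO_ofReal_cpow_atTop s) hs

lemma integrableOn_Ici_cpow_mul_log {x₀ : ℝ} (hx₀ : 0 < x₀) {s : ℂ} (hs : s.re < -1) :
    IntegrableOn (fun x : ℝ => (x : ℂ) ^ s * ((Real.log x : ℝ) : ℂ)) (Set.Ici x₀) := by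
  obtain ⟨a, ha, ha'⟩ := exists_between hs
  exact ((continuousOn_ofReal_cpow_Ici hx₀ s).mul
    (continuousOn_ofReal_log_Ici hx₀)).integrableOn_Ici_of_isBigO_rpow
    (isBigO_ofReal_cpow_mul_log_atTop ha) ha'

lemma tendsto_zero_of_isBigO_rpow_neg {g : ℝ → ℂ} {a : ℝ} (ha : a < 0)
    (ho : g =O[atTop] fun x : ℝ => x ^ a) : Tendsto g atTop (𝓝 0) := by
  refine ho.trans_tendsto ?_
  simpa using tendsto_rpow_neg_atTop (neg_pos.2 ha)

lemma integral_Ici_cpow_mul_log {x₀ : ℝ} (hx₀ : 0 < x₀) {s : ℂ} (hs : s.re < -1) :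
    ∫ x in Set.Ici x₀, (x : ℂ) ^ s * ((Real.log x : ℝ) : ℂ) =
      (x₀ : ℂ) ^ (s + 1) / (s + 1) ^ 2 -
        (x₀ : ℂ) ^ (s + 1) * ((Real.log x₀ : ℝ) : ℂ) / (s + 1) := by
  have hre : (s + 1).re < 0 := by simp; linarith
  have hz : s + 1 ≠ 0 := by
    intro h
    simp [h] at hre
  have hd : ∀ x : ℝ, 0 < x → HasDerivAt
      (fun x : ℝ => (x : ℂ) ^ (s + 1) * ((Real.log x : ℝ) : ℂ) / (s + 1) -
        (x : ℂ) ^ (s + 1) / (s + 1) ^ 2) ((x : ℂ) ^ s * ((Real.log x : ℝ) : ℂ)) x := by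
    intro x hx
    have h1 := hasDerivAt_ofReal_cpow_const hx.ne' hz
    have h2 := (Real.hasDerivAt_log hx.ne').ofReal_comp
    have hx' : (x : ℂ) ≠ 0 := by exact_mod_cast hx.ne'
    have h3 : (x : ℂ) ^ (s + 1) = (x : ℂ) ^ s * x := by
      rw [Complex.cpow_add _ _ hx', Complex.cpow_one]
    refine (((h1.mul h2).div_const (s + 1)).sub (h1.div_const ((s + 1) ^ 2))).congr_deriv ?_
    rw [h3, add_sub_cancel_right]
    push_cast
    field_simp
    ring
  obtain ⟨a, ha, ha'⟩ := exists_between hre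
  have ht : Tendsto (fun x : ℝ => (x : ℂ) ^ (s + 1) * ((Real.log x : ℝ) : ℂ) / (s + 1) -
        (x : ℂ) ^ (s + 1) / (s + 1) ^ 2) atTop (𝓝 0) := by
    simpa using ((tendsto_zero_of_isBigO_rpow_neg ha'
      (isBigO_ofReal_cpow_mul_log_atTop ha)).div_const (s + 1)).sub
      ((tendsto_zero_of_isBigO_rpow_neg hre
        (isBigO_ofReal_cpow_atTop (s + 1))).div_const ((s + 1) ^ 2))
  rw [integral_Ici_eq_integral_Ioi, integral_Ioi_of_hasDerivAt_of_tendsto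
    (hd x₀ hx₀).continuousAt.continuousWithinAt (fun x hx => hd x (hx₀.trans hx))
    ((integrableOn_Ici_cpow_mul_log hx₀ hs).mono_set Set.Ioi_subset_Ici_self) ht]
  ring

/-- The truncated Mellin integral of a rapidly decreasing continuous function converges
everywhere. -/
lemma integrableOn_Ici_cpow_mul_of_rapid_decay {x₀ : ℝ} (hx₀ : 0 < x₀) {ψ : ℝ → ℂ}
    (hψ : ContinuousOn ψ (Set.Ici x₀))
    (hdecay : ∀ N : ℝ, 0 < N → ψ =O[atTop] fun x : ℝ => x ^ (-N)) (s : ℂ) :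
    IntegrableOn (fun x : ℝ => (x : ℂ) ^ s * ψ x) (Set.Ici x₀) := by
  refine ((continuousOn_ofReal_cpow_Ici hx₀ s).mul hψ).integrableOn_Ici_of_isBigO_rpow
    (a := -2) ?_ (by norm_num)
  refine ((isBigO_ofReal_cpow_atTop s).mul (hdecay (|s.re| + 2) (by positivity))).trans ?_
  refine IsBigO.of_bound 1 ?_
  filter_upwards [eventually_ge_atTop 1] with x hx
  have hx0 : 0 < x := by linarith
  rw [← Real.rpow_add hx0, one_mul, Real.norm_of_nonneg (by positivity),
    Real.norm_of_nonneg (by positivity)]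
  exact Real.rpow_le_rpow_of_exponent_le hx (by linarith [le_abs_self s.re])

/-- The truncated Mellin integral of a rapidly decreasing continuous function is entire. -/
lemma differentiable_integral_Ici_cpow_mul_of_rapid_decay {x₀ : ℝ} (hx₀ : 0 < x₀) {ψ : ℝ → ℂ}
    (hψ : ContinuousOn ψ (Set.Ici x₀))
    (hdecay : ∀ N : ℝ, 0 < N → ψ =O[atTop] fun x : ℝ => x ^ (-N)) :
    Differentiable ℂ fun s : ℂ => ∫ x in Set.Ici x₀, (x : ℂ) ^ s * ψ x := by
  set f : ℝ → ℂ := (Set.Ici x₀).indicator ψ with hf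
  have hint : Integrable f := by
    rw [hf, integrable_indicator_iff measurableSet_Ici]
    simpa using integrableOn_Ici_cpow_mul_of_rapid_decay hx₀ hψ hdecay 0
  have heq : (fun s : ℂ => ∫ x in Set.Ici x₀, (x : ℂ) ^ s * ψ x) =
      fun s => mellin f (s + 1) := by
    funext s
    have hind : ∀ t : ℝ, (t : ℂ) ^ (s + 1 - 1) • f t =
        (Set.Ici x₀).indicator (fun t : ℝ => (t : ℂ) ^ s * ψ t) t := by
      intro t
      by_cases ht : t ∈ Set.Ici x₀ <;> simp [hf, ht]
    rw [mellin]
    simp_rw [hind]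
    rw [setIntegral_indicator measurableSet_Ici,
      Set.inter_eq_right.2 (Set.Ici_subset_Ioi.2 hx₀)]
  rw [heq]
  intro s
  have hdiff : DifferentiableAt ℂ (mellin f) (s + 1) := by
    refine mellin_differentiableAt_of_isBigO_rpow (a := |(s + 1).re| + 1) (b := (s + 1).re - 1)
      (hint.locallyIntegrable.locallyIntegrableOn _) ?_ (by linarith [le_abs_self (s + 1).re])
      ?_ (by linarith)
    · refine (hdecay _ (by positivity)).congr' ?_ EventuallyEq.rfl
      filter_upwards [eventually_ge_atTop x₀] with x hx
      simp [hf, hx]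
    · refine (isBigO_zero _ _).congr' ?_ EventuallyEq.rfl
      filter_upwards [mem_nhdsWithin_of_mem_nhds (Iio_mem_nhds hx₀)] with x hx
      rw [hf, Set.indicator_of_notMem]
      simpa using hx
  exact DifferentiableAt.comp (g := mellin f) s hdiff (differentiableAt_id.add_const 1)

lemma setIntegral_Icc_inv_ofReal {x₀ R : ℝ} (hx₀ : 0 < x₀) (hR : x₀ ≤ R) :
    ∫ x in Set.Icc x₀ R, (x : ℂ)⁻¹ = ((Real.log R : ℝ) : ℂ) - ((Real.log x₀ : ℝ) : ℂ) := by
  have hpos : ∀ x ∈ Set.uIcc x₀ R, 0 < x := fun x hx =>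
    hx₀.trans_le (by rw [Set.uIcc_of_le hR] at hx; exact hx.1)
  rw [integral_Icc_eq_integral_Ioc, ← intervalIntegral.integral_of_le hR]
  refine intervalIntegral.integral_eq_sub_of_hasDerivAt
    (f := fun x : ℝ => ((Real.log x : ℝ) : ℂ)) (fun x hx => ?_) ?_
  · simpa using (Real.hasDerivAt_log (hpos x hx).ne').ofReal_comp
  · refine ContinuousOn.intervalIntegrable (Complex.continuous_ofReal.continuousOn.inv₀ ?_)
    exact fun x hx => by exact_mod_cast (hpos x hx).ne'

lemma setIntegral_Icc_inv_mul_log_ofReal {x₀ R : ℝ} (hx₀ : 0 < x₀) (hR : x₀ ≤ R) :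
    ∫ x in Set.Icc x₀ R, (x : ℂ)⁻¹ * ((Real.log x : ℝ) : ℂ) =
      ((Real.log R : ℝ) : ℂ) ^ 2 / 2 - ((Real.log x₀ : ℝ) : ℂ) ^ 2 / 2 := by
  have hpos : ∀ x ∈ Set.uIcc x₀ R, 0 < x := fun x hx =>
    hx₀.trans_le (by rw [Set.uIcc_of_le hR] at hx; exact hx.1)
  rw [integral_Icc_eq_integral_Ioc, ← intervalIntegral.integral_of_le hR]
  refine intervalIntegral.integral_eq_sub_of_hasDerivAt
    (f := fun x : ℝ => ((Real.log x : ℝ) : ℂ) ^ 2 / 2) (fun x hx => ?_) ?_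
  · refine (((Real.hasDerivAt_log (hpos x hx).ne').ofReal_comp.pow 2).div_const 2).congr_deriv ?_
    push_cast
    ring
  · refine ContinuousOn.intervalIntegrable ((Complex.continuous_ofReal.continuousOn.inv₀ ?_).mul
      ((continuousOn_ofReal_log_Ici hx₀).mono ?_))
    · exact fun x hx => by exact_mod_cast (hpos x hx).ne'
    · rw [Set.uIcc_of_le hR]
      exact Set.Icc_subset_Ici_self

/-- **Meromorphic continuation of `F(λ) = ∫_{x₀}^∞ x^λ φ(x) dx` and its finite part
(Example 1 of the paper).**
If `φ` is continuous on `[x₀, ∞)` with `φ(x) = A x^β + B x^β ln x + O(x^{-N})` for every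
`N`, then there is `F` holomorphic on `ℂ ∖ {-β-1}` with:
(i) `F(λ) = ∫_{x₀}^∞ x^λ φ(x) dx` (absolutely convergent) for `Re λ < -Re β - 1`;
(ii) `F` has at `-β-1` a pole of order at most `2` with singular part
`B(λ+β+1)^{-2} - A(λ+β+1)^{-1}`, i.e. `F(λ) - B/(λ+β+1)² + A/(λ+β+1)` extends to an
entire function `G`;
(iii) the finite part `G(-β-1)` equals
`lim_{R→∞} [∫_{x₀}^R x^{-β-1} φ(x) dx - A ln R - (B/2)(ln R)²]`, which limit exists. -/
theorem finitePart_mellin_asymptotic (x₀ : ℝ) (hx₀ : 0 < x₀) (β A B : ℂ)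
    (φ : ℝ → ℂ) (hcont : ContinuousOn φ (Set.Ici x₀))
    (hasymp : ∀ N : ℝ, 0 < N →
      (fun x : ℝ => φ x - A * (x : ℂ) ^ β - B * (x : ℂ) ^ β * ((Real.log x : ℝ) : ℂ))
        =O[atTop] fun x : ℝ => x ^ (-N)) :
    ∃ F : ℂ → ℂ,
      DifferentiableOn ℂ F {-β - 1}ᶜ ∧
      (∀ lam : ℂ, lam.re < -β.re - 1 →
        IntegrableOn (fun x : ℝ => (x : ℂ) ^ lam * φ x) (Set.Ici x₀) ∧
        F lam = ∫ x in Set.Ici x₀, (x : ℂ) ^ lam * φ x) ∧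
      ∃ G : ℂ → ℂ,
        Differentiable ℂ G ∧
        (∀ lam : ℂ, lam ≠ -β - 1 →
          G lam = F lam - B / (lam + β + 1) ^ 2 + A / (lam + β + 1)) ∧
        Tendsto
          (fun R : ℝ =>
            (∫ x in Set.Icc x₀ R, (x : ℂ) ^ (-β - 1) * φ x) -
              A * ((Real.log R : ℝ) : ℂ) - (B / 2) * ((Real.log R : ℝ) : ℂ) ^ 2)
          atTop (𝓝 (G (-β - 1))) := by
  set ψ : ℝ → ℂ := fun x =>
    φ x - A * (x : ℂ) ^ β - B * (x : ℂ) ^ β * ((Real.log x : ℝ) : ℂ) with hψdef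
  have hβ := continuousOn_ofReal_cpow_Ici hx₀ β
  have hlog := continuousOn_ofReal_log_Ici hx₀
  have hψ : ContinuousOn ψ (Set.Ici x₀) :=
    (hcont.sub (continuousOn_const.mul hβ)).sub ((continuousOn_const.mul hβ).mul hlog)
  have hH := differentiable_integral_Ici_cpow_mul_of_rapid_decay hx₀ hψ hasymp
  have hHint := integrableOn_Ici_cpow_mul_of_rapid_decay hx₀ hψ hasymp
  set H : ℂ → ℂ := fun s => ∫ x in Set.Ici x₀, (x : ℂ) ^ s * ψ x with hHdef
  set L : ℂ := ((Real.log x₀ : ℝ) : ℂ) with hL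
  have hsplit : ∀ lam : ℂ, ∀ x ∈ Set.Ici x₀, (x : ℂ) ^ lam * φ x =
      (x : ℂ) ^ lam * ψ x + A * (x : ℂ) ^ (lam + β) +
        B * ((x : ℂ) ^ (lam + β) * ((Real.log x : ℝ) : ℂ)) := by
    intro lam x hx
    have hx' : (x : ℂ) ≠ 0 := by exact_mod_cast (hx₀.trans_le hx).ne'
    rw [hψdef, Complex.cpow_add _ _ hx']
    ring
  have hpow : ∀ z : ℂ, (x₀ : ℂ) ^ z = Complex.exp (z * L) := by
    intro z
    rw [Complex.cpow_def_of_ne_zero (by exact_mod_cast hx₀.ne'), hL, Complex.ofReal_log hx₀.le,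
      mul_comm]
  obtain ⟨e, he, he0, hexp⟩ := exists_entire_exp_second_quotient
  refine ⟨fun lam => H lam - A * (Complex.exp ((lam + β + 1) * L) / (lam + β + 1)) +
    B * (Complex.exp ((lam + β + 1) * L) / (lam + β + 1) ^ 2 -
      Complex.exp ((lam + β + 1) * L) * L / (lam + β + 1)), ?_, ?_,
    fun lam => H lam - A * (L * (1 + (lam + β + 1) * L * e ((lam + β + 1) * L))) +
      B * (L ^ 2 * (-1 + e ((lam + β + 1) * L) * (1 - (lam + β + 1) * L))), ?_, ?_, ?_⟩
  · intro lam hlam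
    have hz : lam + β + 1 ≠ 0 := fun h => hlam (by
      rw [Set.mem_singleton_iff]
      linear_combination h)
    have hHl := hH lam
    refine DifferentiableAt.differentiableWithinAt ?_
    fun_prop (disch := simp [hz])
  · intro lam hlam
    have hs : (lam + β).re < -1 := by
      rw [Complex.add_re]
      linarith
    have i1 := hHint lam
    have i2 := (integrableOn_Ici_cpow hx₀ hs).const_mul A
    have i3 := (integrableOn_Ici_cpow_mul_log hx₀ hs).const_mul B
    refine ⟨((i1.add i2).add i3).congr_fun (fun x hx => (hsplit lam x hx).symm)
      measurableSet_Ici, ?_⟩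
    rw [setIntegral_congr_fun measurableSet_Ici (hsplit lam), integral_add (by exact i1.add i2) i3,
      integral_add i1 i2, integral_const_mul, integral_const_mul,
      integral_Ici_cpow_mul_log hx₀ hs,
      integral_Ici_eq_integral_Ioi (f := fun x : ℝ => (x : ℂ) ^ (lam + β)),
      integral_Ioi_cpow_of_lt hs hx₀, hpow]
    ring
  · fun_prop
  · intro lam hlam
    have hz : lam + β + 1 ≠ 0 := fun h => hlam (by linear_combination h)
    simp only [hexp ((lam + β + 1) * L)]
    field_simp
    ring
  · have hz : -β - 1 + β + 1 = 0 := by ring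
    simp only [hz, zero_mul, he0]
    have hlim : Tendsto (fun R : ℝ => ∫ x in x₀..R, (x : ℂ) ^ (-β - 1) * ψ x) atTop
        (𝓝 (H (-β - 1))) := by
      rw [hHdef]
      simp only [integral_Ici_eq_integral_Ioi]
      exact intervalIntegral_tendsto_integral_Ioi x₀
        ((hHint _).mono_set Set.Ioi_subset_Ici_self) tendsto_id
    have hlim' := (hlim.sub_const (A * L)).sub_const (B / 2 * L ^ 2)
    refine (hlim'.congr' ?_).trans (le_of_eq ?_)
    · filter_upwards [eventually_ge_atTop x₀] with R hR
      have hsub : Set.Icc x₀ R ⊆ Set.Ici x₀ := Set.Icc_subset_Ici_self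
      have hinv : ContinuousOn (fun x : ℝ => (x : ℂ)⁻¹) (Set.Icc x₀ R) :=
        Complex.continuous_ofReal.continuousOn.inv₀ fun x hx => by
          exact_mod_cast (hx₀.trans_le hx.1).ne'
      have i1 := (hHint (-β - 1)).mono_set hsub
      have i2 : IntegrableOn (fun x : ℝ => A * (x : ℂ)⁻¹) (Set.Icc x₀ R) :=
        (continuousOn_const.mul hinv).integrableOn_Icc
      have i3 : IntegrableOn (fun x : ℝ => B * ((x : ℂ)⁻¹ * ((Real.log x : ℝ) : ℂ)))
          (Set.Icc x₀ R) :=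
        (continuousOn_const.mul (hinv.mul (hlog.mono hsub))).integrableOn_Icc
      have hsplit' : ∀ x ∈ Set.Icc x₀ R, (x : ℂ) ^ (-β - 1) * φ x =
          (x : ℂ) ^ (-β - 1) * ψ x + A * (x : ℂ)⁻¹ +
            B * ((x : ℂ)⁻¹ * ((Real.log x : ℝ) : ℂ)) := by
        intro x hx
        rw [hsplit _ x (hsub hx), show -β - 1 + β = -1 by ring, Complex.cpow_neg_one]
      rw [setIntegral_congr_fun measurableSet_Icc hsplit', integral_add (by exact i1.add i2) i3,
        integral_add i1 i2, integral_const_mul, integral_const_mul,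
        setIntegral_Icc_inv_ofReal hx₀ hR, setIntegral_Icc_inv_mul_log_ofReal hx₀ hR,
        intervalIntegral.integral_of_le hR, ← integral_Icc_eq_integral_Ioc]
      ring
    · congr 1
      ring
end

section
/- Let n ≥ 1 and let φ : ℝ^n → ℂ be a Schwartz function. Then there exists a function F, holomorphic on ℂ ∖ {−n−2m : m ∈ ℕ}, such that F(λ) = ∫_{ℝ^n} |x|^λ φ(x) dx for all λ with Re λ > −n (where the integral converges absolutely), and for each m ∈ ℕ, F has at λ = −n−2m at worst a simple pole with lim_{λ→−n−2m} (λ+n+2m) F(λ) = (c_{m,n}/(2m)!) (Δ^m φ)(0), where c_{m,n} = 2Γ(m+1/2)π^{(n−1)/2}/Γ(m+n/2). In particular the analytic continuation of λ ↦ ∫_{ℝ^n} |x|^λ φ(x) dx has no singularities at the points −n−(2m+1), m ∈ ℕ. (This encodes the Laurent expansion r^λ = c_{m,n}∇^{2m}δ/((2m)!(λ+2m+n)) + Pf(r^{−n−2m}) + O(λ+2m+n), tested against φ.) -/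
open MeasureTheory Filter Topology

/-- The Laplacian `Δf = ∑ ∂²f/∂x_i²` on `ℝ^n`. -/
noncomputable def lap {n : ℕ} (f : EuclideanSpace ℝ (Fin n) → ℂ) :
    EuclideanSpace ℝ (Fin n) → ℂ :=
  fun x => ∑ i : Fin n,
    fderiv ℝ (fun y => fderiv ℝ f y (EuclideanSpace.single i 1)) x (EuclideanSpace.single i 1)

/-- The constant `c_{m,n} = 2 Γ(m + 1/2) π^{(n-1)/2} / Γ(m + n/2)`. -/
noncomputable def cmn (m n : ℕ) : ℝ :=
  2 * Real.Gamma ((m : ℝ) + 1 / 2) * Real.pi ^ (((n : ℝ) - 1) / 2) /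
    Real.Gamma ((m : ℝ) + (n : ℝ) / 2)

theorem integrable_radial_of_bounds {n : ℕ} (hn : 1 ≤ n) {f : EuclideanSpace ℝ (Fin n) → ℂ}
    (hf : AEStronglyMeasurable f) (a : ℕ)
    (hb : ∀ k : ℕ, ∃ C : ℝ, ∀ x, ‖x‖ ^ k * ‖f x‖ ≤ C * ‖x‖ ^ a) {τ : ℝ}
    (hτ : -((n : ℝ) + a) < τ) :
    Integrable (fun x : EuclideanSpace ℝ (Fin n) => ‖x‖ ^ τ * ‖f x‖) := by
  have : Nonempty (Fin n) := ⟨⟨0, hn⟩⟩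
  obtain ⟨N, hN⟩ := exists_nat_gt (τ + a + n)
  obtain ⟨C, hC⟩ := hb 0
  obtain ⟨D, hD⟩ := hb N
  have hpow : ∀ (σ r : ℝ), 0 < r → r ^ (n - 1) * r ^ σ = r ^ (σ + n - 1) := by
    intro σ r hr
    rw [← Real.rpow_natCast, ← Real.rpow_add hr, Nat.cast_sub hn]
    congr 1
    push_cast
    ring
  let g : ℝ → ℝ := fun r => if r ≤ 1 then C * r ^ (τ + a) else D * r ^ (τ + a - N)
  have hg : Integrable (fun x : EuclideanSpace ℝ (Fin n) => g ‖x‖) := by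
    rw [integrable_fun_norm_addHaar volume, finrank_euclideanSpace_fin,
      ← Set.Ioc_union_Ioi_eq_Ioi (zero_le_one' ℝ)]
    refine IntegrableOn.union ?_ ?_
    · have h1 : IntegrableOn (fun r : ℝ => C * r ^ (τ + a + n - 1)) (Set.Ioc 0 1) := by
        rw [← intervalIntegrable_iff_integrableOn_Ioc_of_le zero_le_one]
        exact (intervalIntegral.intervalIntegrable_rpow' (by linarith)).const_mul _
      refine h1.congr_fun (fun r hr => ?_) measurableSet_Ioc
      simp only [g, if_pos hr.2, smul_eq_mul]
      rw [← hpow _ _ hr.1]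
      ring
    · have h1 : IntegrableOn (fun r : ℝ => D * r ^ (τ + a - N + n - 1)) (Set.Ioi 1) :=
        (integrableOn_Ioi_rpow_of_lt (by linarith) zero_lt_one).const_mul _
      refine h1.congr_fun (fun r hr => ?_) measurableSet_Ioi
      have hr' : (1 : ℝ) < r := hr
      simp only [g, if_neg (not_le.2 hr'), smul_eq_mul]
      rw [← hpow _ _ (by linarith)]
      ring
  refine hg.mono' ?_ ?_
  · exact (measurable_norm.pow_const τ).aestronglyMeasurable.mul hf.norm
  · have h0 : ∀ᵐ x : EuclideanSpace ℝ (Fin n), x ≠ 0 := by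
      simp [ae_iff]
    filter_upwards [h0] with x hx
    have hr : 0 < ‖x‖ := norm_pos_iff.2 hx
    rw [Real.norm_of_nonneg (by positivity)]
    simp only [g]
    split_ifs with h
    · rw [Real.rpow_add hr, Real.rpow_natCast]
      have := hC x
      rw [pow_zero, one_mul] at this
      calc _ ≤ ‖x‖ ^ τ * (C * ‖x‖ ^ a) := by gcongr
        _ = _ := by ring
    · rw [Real.rpow_sub hr, Real.rpow_add hr, Real.rpow_natCast, Real.rpow_natCast]
      have := hD x
      rw [← mul_div_assoc, le_div_iff₀ (by positivity)]
      calc _ = ‖x‖ ^ τ * (‖x‖ ^ N * ‖f x‖) := by ring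
        _ ≤ ‖x‖ ^ τ * (D * ‖x‖ ^ a) := by gcongr
        _ = _ := by ring

theorem norm_cpow_le_rpow {r : ℝ} (hr : 0 ≤ r) (z : ℂ) (hz : z ≠ 0 ∨ r ≠ 0) :
    ‖(r : ℂ) ^ z‖ ≤ r ^ z.re := by
  rcases hr.eq_or_lt with rfl | hr
  · have : z ≠ 0 := by simpa using hz
    simp [Complex.zero_cpow this, Real.rpow_nonneg]
  · rw [Complex.norm_cpow_eq_rpow_re_of_pos hr]

theorem integrable_cpow_radial_of_bounds {n : ℕ} (hn : 1 ≤ n) {f : EuclideanSpace ℝ (Fin n) → ℂ}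
    (hf : AEStronglyMeasurable f) (a : ℕ)
    (hb : ∀ k : ℕ, ∃ C : ℝ, ∀ x, ‖x‖ ^ k * ‖f x‖ ≤ C * ‖x‖ ^ a) {z : ℂ}
    (hz : -((n : ℝ) + a) < z.re) :
    Integrable (fun x : EuclideanSpace ℝ (Fin n) => (‖x‖ : ℂ) ^ z * f x) := by
  have : Nonempty (Fin n) := ⟨⟨0, hn⟩⟩
  refine (integrable_radial_of_bounds hn hf a hb hz).mono' ?_ ?_
  · exact ((Complex.measurable_ofReal.comp measurable_norm).pow_const z).aestronglyMeasurable.mul hf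
  · have h0 : ∀ᵐ x : EuclideanSpace ℝ (Fin n), x ≠ 0 := by
      simp [ae_iff]
    filter_upwards [h0] with x hx
    rw [norm_mul]
    gcongr
    exact norm_cpow_le_rpow (norm_nonneg _) _ (Or.inr (norm_ne_zero_iff.2 hx))

theorem abs_log_mul_rpow_le {r ε σ s : ℝ} (hr : 0 < r) (hε : 0 < ε) (hs : |s - σ| ≤ ε) :
    |Real.log r| * r ^ s ≤ (r ^ (σ + 2 * ε) + r ^ (σ - 2 * ε)) / ε := by
  rw [le_div_iff₀ hε]
  obtain ⟨h1, h2⟩ := abs_le.1 hs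
  rcases le_total 1 r with h | h
  · rw [abs_of_nonneg (Real.log_nonneg h)]
    have hl := Real.log_le_rpow_div hr.le hε
    rw [le_div_iff₀ hε] at hl
    calc _ = (Real.log r * ε) * r ^ s := by ring
      _ ≤ r ^ ε * r ^ s := by gcongr
      _ = r ^ (ε + s) := (Real.rpow_add hr _ _).symm
      _ ≤ r ^ (σ + 2 * ε) := Real.rpow_le_rpow_of_exponent_le h (by linarith)
      _ ≤ _ := le_add_of_nonneg_right (by positivity)
  · rw [abs_of_nonpos (Real.log_nonpos hr.le h)]
    have hl := Real.log_le_rpow_div (inv_pos.2 hr).le hε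
    rw [le_div_iff₀ hε, Real.log_inv, Real.inv_rpow hr.le, ← Real.rpow_neg hr.le] at hl
    calc _ = (-Real.log r * ε) * r ^ s := by ring
      _ ≤ r ^ (-ε) * r ^ s := by gcongr
      _ = r ^ (-ε + s) := (Real.rpow_add hr _ _).symm
      _ ≤ r ^ (σ - 2 * ε) := Real.rpow_le_rpow_of_exponent_ge hr h (by linarith)
      _ ≤ _ := le_add_of_nonneg_left (by positivity)

theorem differentiableAt_integral_cpow_radial {n : ℕ} (hn : 1 ≤ n)
    {f : EuclideanSpace ℝ (Fin n) → ℂ}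
    (hf : AEStronglyMeasurable f) (a : ℕ)
    (hb : ∀ k : ℕ, ∃ C : ℝ, ∀ x, ‖x‖ ^ k * ‖f x‖ ≤ C * ‖x‖ ^ a) {z : ℂ}
    (hz : -((n : ℝ) + a) < z.re) :
    DifferentiableAt ℂ (fun w : ℂ => ∫ x : EuclideanSpace ℝ (Fin n), (‖x‖ : ℂ) ^ w * f x) z := by
  have : Nonempty (Fin n) := ⟨⟨0, hn⟩⟩
  have h0 : ∀ᵐ x : EuclideanSpace ℝ (Fin n), x ≠ 0 := by
    simp [ae_iff]
  have hm : ∀ w : ℂ, AEStronglyMeasurable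
      (fun x : EuclideanSpace ℝ (Fin n) => (‖x‖ : ℂ) ^ w * f x) := fun w =>
    ((Complex.measurable_ofReal.comp measurable_norm).pow_const w).aestronglyMeasurable.mul hf
  let ε : ℝ := (z.re + (n + a)) / 3
  have hε : 0 < ε := by simp only [ε]; linarith
  have hε3 : 3 * ε = z.re + (n + a) := by simp only [ε]; ring
  refine (hasDerivAt_integral_of_dominated_loc_of_deriv_le
    (F := fun (w : ℂ) (x : EuclideanSpace ℝ (Fin n)) => (‖x‖ : ℂ) ^ w * f x)
    (F' := fun w x => Complex.log ‖x‖ * ((‖x‖ : ℂ) ^ w * f x))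
    (bound := fun x => (‖x‖ ^ (z.re + 2 * ε) * ‖f x‖ + ‖x‖ ^ (z.re - 2 * ε) * ‖f x‖) / ε)
    (Metric.ball_mem_nhds z hε) (Eventually.of_forall hm)
    (integrable_cpow_radial_of_bounds hn hf a hb hz) ?_ ?_ ?_ ?_).2.differentiableAt
  · exact (Complex.measurable_log.comp
      (Complex.measurable_ofReal.comp measurable_norm)).aestronglyMeasurable.mul (hm z)
  · filter_upwards [h0] with x hx w hw
    have hr : 0 < ‖x‖ := norm_pos_iff.2 hx
    rw [norm_mul, norm_mul, Complex.norm_cpow_eq_rpow_re_of_pos hr, ← Complex.ofReal_log hr.le,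
      Complex.norm_real, Real.norm_eq_abs, ← mul_assoc, ← add_mul, mul_div_right_comm]
    gcongr
    apply abs_log_mul_rpow_le hr hε
    rw [← Complex.sub_re]
    exact (Complex.abs_re_le_norm _).trans (mem_ball_iff_norm.1 hw).le
  · exact ((integrable_radial_of_bounds hn hf a hb (by linarith)).add
      (integrable_radial_of_bounds hn hf a hb (by linarith))).div_const _
  · filter_upwards [h0] with x hx w hw
    have hr : (‖x‖ : ℂ) ≠ 0 := by simpa using hx
    have := ((hasDerivAt_id w).const_cpow (Or.inl hr)).mul_const (f x)
    convert! this using 1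
    simp only [id]
    ring

theorem SchwartzMap.norm_pow_mul_le {n : ℕ} (φ : SchwartzMap (EuclideanSpace ℝ (Fin n)) ℂ) (k : ℕ) :
    ∃ C : ℝ, ∀ x, ‖x‖ ^ k * ‖φ x‖ ≤ C * ‖x‖ ^ 0 := by
  obtain ⟨C, -, hC⟩ := φ.decay k 0
  exact ⟨C, fun x => by simpa using hC x⟩

open scoped Laplacian LineDeriv InnerProductSpace

theorem SchwartzMap.coe_laplacian_eq_lap {n : ℕ} (φ : SchwartzMap (EuclideanSpace ℝ (Fin n)) ℂ) :
    ⇑(Δ φ : SchwartzMap (EuclideanSpace ℝ (Fin n)) ℂ) = lap ⇑φ := by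
  ext x
  rw [SchwartzMap.laplacian_eq_sum (EuclideanSpace.basisFun (Fin n) ℝ), sum_apply]
  simp only [EuclideanSpace.basisFun_apply]
  rfl

theorem integrable_cpow_mul_coord_pow_mul {n : ℕ} (hn : 1 ≤ n)
    (ψ : SchwartzMap (EuclideanSpace ℝ (Fin n)) ℂ) (i : Fin n) (j : ℕ) {z : ℂ}
    (hz : -(n : ℝ) < z.re) :
    Integrable (fun x : EuclideanSpace ℝ (Fin n) => (‖x‖ : ℂ) ^ z * ((x i : ℂ) ^ j * ψ x)) := by
  refine integrable_cpow_radial_of_bounds hn ?_ 0 (fun k => ?_) (by simpa using hz)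
  · exact (Continuous.mul (by fun_prop) ψ.continuous).aestronglyMeasurable
  · obtain ⟨C, hC⟩ := ψ.norm_pow_mul_le (k + j)
    refine ⟨C, fun x => le_trans ?_ (hC x)⟩
    rw [norm_mul, norm_pow, Complex.norm_real, pow_add, mul_assoc]
    gcongr
    exact PiLp.norm_apply_le x i

theorem hasLineDerivAt_norm_cpow {E : Type*} [NormedAddCommGroup E] [InnerProductSpace ℝ E]
    {z : ℂ} (hz : 1 < z.re) (x v : E) :
    HasLineDerivAt ℝ (fun y : E => (‖y‖ : ℂ) ^ z) (z * (‖x‖ : ℂ) ^ (z - 2) * (⟪x, v⟫_ℝ : ℝ)) x v := by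
  have hz0 : z ≠ 0 := by rintro rfl; norm_num at hz
  rcases eq_or_ne x 0 with rfl | hx
  · have h := hasFDerivAt_norm_rpow (0 : E) hz
    simp only [map_zero, smul_zero] at h
    have h2 : HasFDerivAt (fun y : E => (‖y‖ : ℂ) ^ z) (0 : E →L[ℝ] ℂ) 0 := by
      rw [hasFDerivAt_iff_isLittleO_nhds_zero] at h ⊢
      refine (Asymptotics.IsBigO.of_bound 1 (Eventually.of_forall fun y => ?_)).trans_isLittleO h
      have hre : z.re ≠ 0 := by linarith
      simp [Complex.zero_cpow hz0, Real.zero_rpow hre,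
        Complex.norm_cpow_eq_rpow_re_of_nonneg (norm_nonneg y) hre, le_abs_self]
    simpa using h2.hasLineDerivAt v
  · have hr : 0 < ‖x‖ := norm_pos_iff.2 hx
    have hr' : (‖x‖ : ℂ) ≠ 0 := by simpa using hx
    have hl : HasDerivAt (fun t : ℝ => x + t • v) v 0 := by
      simpa using ((hasDerivAt_id (0 : ℝ)).smul_const v).const_add x
    have h1 : HasDerivAt (fun t : ℝ => ‖x + t • v‖ ^ 2) (2 * ⟪x, v⟫_ℝ) 0 := by
      simpa using hl.norm_sq
    have h2 : HasDerivAt (fun t : ℝ => ‖x + t • v‖) (⟪x, v⟫_ℝ / ‖x‖) 0 := by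
      have h3 := h1.sqrt (by simp [hx])
      simp only [zero_smul, add_zero, norm_nonneg, Real.sqrt_sq] at h3
      convert h3 using 1
      field_simp
    have h4 := (Complex.hasStrictDerivAt_cpow_const (x := (‖x‖ : ℂ)) (c := z)
      (by simp [hr])).hasDerivAt.comp_of_eq (0 : ℝ) h2.ofReal_comp (by simp)
    unfold HasLineDerivAt
    convert! h4 using 1
    rw [show z - 2 = z - 1 - 1 by ring, Complex.cpow_sub _ _ hr', Complex.cpow_one]
    push_cast
    field_simp

theorem hasLineDerivAt_norm_cpow_mul_coord {n : ℕ} {z : ℂ} (hz : 1 < z.re)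
    (x : EuclideanSpace ℝ (Fin n)) (i : Fin n) :
    HasLineDerivAt ℝ (fun y : EuclideanSpace ℝ (Fin n) => (‖y‖ : ℂ) ^ z * (y i : ℂ))
      ((‖x‖ : ℂ) ^ z + z * (‖x‖ : ℂ) ^ (z - 2) * (x i : ℂ) ^ 2) x (EuclideanSpace.single i 1) := by
  have h1 := hasLineDerivAt_norm_cpow hz x (EuclideanSpace.single i (1 : ℝ))
  unfold HasLineDerivAt at h1 ⊢
  have h2 : HasDerivAt (fun t : ℝ => ((x + t • EuclideanSpace.single i (1 : ℝ)) i : ℂ)) 1 0 := by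
    simpa using ((hasDerivAt_id (0 : ℝ)).const_add (x i)).ofReal_comp
  convert! h1.mul h2 using 1
  simp [EuclideanSpace.inner_single_right]
  ring

theorem integral_norm_cpow_mul_lineDeriv_lineDeriv {n : ℕ} (hn : 1 ≤ n)
    (φ : SchwartzMap (EuclideanSpace ℝ (Fin n)) ℂ) {z : ℂ} (hz : 1 < z.re) (i : Fin n) :
    ∫ x : EuclideanSpace ℝ (Fin n), (‖x‖ : ℂ) ^ (z + 2) *
      (∂_{EuclideanSpace.single i (1 : ℝ)} (∂_{EuclideanSpace.single i (1 : ℝ)} φ) :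
        SchwartzMap (EuclideanSpace ℝ (Fin n)) ℂ) x =
    ∫ x : EuclideanSpace ℝ (Fin n), (z + 2) *
      ((‖x‖ : ℂ) ^ z + z * (‖x‖ : ℂ) ^ (z - 2) * (x i : ℂ) ^ 2) * φ x := by
  set v : EuclideanSpace ℝ (Fin n) := EuclideanSpace.single i (1 : ℝ) with hv
  have hn' : (1 : ℝ) ≤ n := by exact_mod_cast hn
  have hz2 : 1 < (z + 2).re := by simp; linarith
  have hint : ∀ (ψ : SchwartzMap (EuclideanSpace ℝ (Fin n)) ℂ) (j : ℕ) (w : ℂ), -1 < w.re →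
      Integrable (fun x : EuclideanSpace ℝ (Fin n) => (‖x‖ : ℂ) ^ w * ((x i : ℂ) ^ j * ψ x)) :=
    fun ψ j w hw => integrable_cpow_mul_coord_pow_mul hn ψ i j (by linarith)
  have hD : ∀ (ψ : SchwartzMap (EuclideanSpace ℝ (Fin n)) ℂ) x,
      HasLineDerivAt ℝ ψ ((∂_{v} ψ : SchwartzMap (EuclideanSpace ℝ (Fin n)) ℂ) x) x v :=
    fun ψ x => (ψ.hasFDerivAt x).hasLineDerivAt v
  have hA : ∀ x : EuclideanSpace ℝ (Fin n), HasLineDerivAt ℝ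
      (fun y : EuclideanSpace ℝ (Fin n) => (‖y‖ : ℂ) ^ (z + 2))
      ((z + 2) * ((‖x‖ : ℂ) ^ z * (x i : ℂ))) x v := by
    intro x
    convert! hasLineDerivAt_norm_cpow hz2 x v using 1
    simp [hv, EuclideanSpace.inner_single_right, mul_assoc]
  have hB : ∀ x : EuclideanSpace ℝ (Fin n), HasLineDerivAt ℝ
      (fun y : EuclideanSpace ℝ (Fin n) => (z + 2) * ((‖y‖ : ℂ) ^ z * (y i : ℂ)))
      ((z + 2) * ((‖x‖ : ℂ) ^ z + z * (‖x‖ : ℂ) ^ (z - 2) * (x i : ℂ) ^ 2)) x v := fun x =>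
    HasDerivAt.const_mul _ (hasLineDerivAt_norm_cpow_mul_coord hz x i)
  have e1 := integral_bilinear_hasLineDerivAt_right_eq_neg_left_of_integrable
    (μ := (volume : Measure (EuclideanSpace ℝ (Fin n)))) (B := ContinuousLinearMap.mul ℝ ℂ)
    (f := fun y => (‖y‖ : ℂ) ^ (z + 2)) (g := (∂_{v} φ : SchwartzMap _ ℂ))
    (v := v) (f' := fun x => (z + 2) * ((‖x‖ : ℂ) ^ z * (x i : ℂ)))
    (g' := (∂_{v} (∂_{v} φ) : SchwartzMap _ ℂ)) ?_ ?_ ?_ (fun x _ => hA x) (fun x _ => hD _ x)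
  have e2 := integral_bilinear_hasLineDerivAt_right_eq_neg_left_of_integrable
    (μ := (volume : Measure (EuclideanSpace ℝ (Fin n)))) (B := ContinuousLinearMap.mul ℝ ℂ)
    (f := fun x => (z + 2) * ((‖x‖ : ℂ) ^ z * (x i : ℂ))) (g := φ)
    (v := v) (f' := fun x => (z + 2) * ((‖x‖ : ℂ) ^ z + z * (‖x‖ : ℂ) ^ (z - 2) * (x i : ℂ) ^ 2))
    (g' := (∂_{v} φ : SchwartzMap _ ℂ)) ?_ ?_ ?_ (fun x _ => hB x) (fun x _ => hD _ x)
  · simp only [ContinuousLinearMap.mul_apply'] at e1 e2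
    rw [e1, e2, neg_neg]
  · refine ((hint φ 0 z (by linarith)).const_mul (z + 2)).add
      ((hint φ 2 (z - 2) (by simp; linarith)).const_mul ((z + 2) * z)) |>.congr
      (Eventually.of_forall fun x => ?_)
    simp only [ContinuousLinearMap.mul_apply', Pi.add_apply]
    ring
  · refine ((hint (∂_{v} φ) 1 z (by linarith)).const_mul (z + 2)).congr
      (Eventually.of_forall fun x => ?_)
    simp only [ContinuousLinearMap.mul_apply']
    ring
  · refine ((hint φ 1 z (by linarith)).const_mul (z + 2)).congr
      (Eventually.of_forall fun x => ?_)
    simp only [ContinuousLinearMap.mul_apply']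
    ring
  · refine ((hint (∂_{v} φ) 1 z (by linarith)).const_mul (z + 2)).congr
      (Eventually.of_forall fun x => ?_)
    simp only [ContinuousLinearMap.mul_apply']
    ring
  · refine (hint (∂_{v} (∂_{v} φ)) 0 (z + 2) (by linarith)).congr
      (Eventually.of_forall fun x => ?_)
    simp
  · refine (hint (∂_{v} φ) 0 (z + 2) (by linarith)).congr
      (Eventually.of_forall fun x => ?_)
    simp

theorem integral_lineDeriv_eq_zero {n : ℕ} (ψ : SchwartzMap (EuclideanSpace ℝ (Fin n)) ℂ)
    (v : EuclideanSpace ℝ (Fin n)) :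
    ∫ x, (∂_{v} ψ : SchwartzMap (EuclideanSpace ℝ (Fin n)) ℂ) x = 0 := by
  have e := integral_bilinear_hasLineDerivAt_right_eq_neg_left_of_integrable
    (μ := (volume : Measure (EuclideanSpace ℝ (Fin n)))) (B := ContinuousLinearMap.mul ℝ ℂ)
    (f := fun _ => (1 : ℂ)) (f' := fun _ => 0) (g := ψ) (v := v)
    (g' := (∂_{v} ψ : SchwartzMap _ ℂ)) (by simp)
    (by simpa using (∂_{v} ψ : SchwartzMap (EuclideanSpace ℝ (Fin n)) ℂ).integrable)
    (by simpa using ψ.integrable) (fun x _ => (hasFDerivAt_const _ _).hasLineDerivAt v)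
    (fun x _ => (ψ.hasFDerivAt x).hasLineDerivAt v)
  simpa using e

theorem integral_laplacian_eq_zero {n : ℕ} (φ : SchwartzMap (EuclideanSpace ℝ (Fin n)) ℂ) :
    ∫ x, (Δ φ) x = 0 := by
  rw [SchwartzMap.laplacian_eq_sum (EuclideanSpace.basisFun (Fin n) ℝ)]
  simp only [sum_apply]
  rw [integral_finsetSum _ fun i _ => SchwartzMap.integrable _]
  exact Finset.sum_eq_zero fun i _ => integral_lineDeriv_eq_zero _ _

theorem integral_norm_cpow_mul_laplacian_of_one_lt {n : ℕ} (hn : 1 ≤ n)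
    (φ : SchwartzMap (EuclideanSpace ℝ (Fin n)) ℂ) {z : ℂ} (hz : 1 < z.re) :
    ∫ x : EuclideanSpace ℝ (Fin n), (‖x‖ : ℂ) ^ (z + 2) * (Δ φ) x =
      (z + 2) * (z + n) * ∫ x : EuclideanSpace ℝ (Fin n), (‖x‖ : ℂ) ^ z * φ x := by
  have hn' : (1 : ℝ) ≤ n := by exact_mod_cast hn
  have hint : ∀ (ψ : SchwartzMap (EuclideanSpace ℝ (Fin n)) ℂ) (i : Fin n) (j : ℕ) (w : ℂ),
      -1 < w.re →
      Integrable (fun x : EuclideanSpace ℝ (Fin n) => (‖x‖ : ℂ) ^ w * ((x i : ℂ) ^ j * ψ x)) :=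
    fun ψ i j w hw => integrable_cpow_mul_coord_pow_mul hn ψ i j (by linarith)
  rw [SchwartzMap.laplacian_eq_sum (EuclideanSpace.basisFun (Fin n) ℝ)]
  simp only [sum_apply, Finset.mul_sum, EuclideanSpace.basisFun_apply]
  rw [integral_finsetSum]
  · simp only [integral_norm_cpow_mul_lineDeriv_lineDeriv hn φ hz]
    rw [← integral_finsetSum, ← integral_const_mul]
    · congr 1
      ext x
      rw [← Finset.sum_mul, ← Finset.mul_sum, Finset.sum_add_distrib, ← Finset.mul_sum]
      have h1 : ∑ i, (x i : ℂ) ^ 2 = (‖x‖ : ℂ) ^ 2 := by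
        rw [← Complex.ofReal_pow, EuclideanSpace.real_norm_sq_eq]
        push_cast
        rfl
      have h2 : (‖x‖ : ℂ) ^ (z - 2) * (‖x‖ : ℂ) ^ 2 = (‖x‖ : ℂ) ^ z := by
        rcases eq_or_ne x 0 with rfl | hx
        · have hz0 : z ≠ 0 := by rintro rfl; norm_num at hz
          simp [Complex.zero_cpow hz0]
        · have hr' : (‖x‖ : ℂ) ≠ 0 := by simpa using hx
          rw [Complex.cpow_sub _ _ hr', Complex.cpow_ofNat]
          field_simp
      rw [h1, mul_assoc z, h2]
      simp
      ring
    · intro i _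
      refine ((hint φ i 0 z (by linarith)).const_mul (z + 2)).add
        ((hint φ i 2 (z - 2) (by simp; linarith)).const_mul ((z + 2) * z)) |>.congr
        (Eventually.of_forall fun x => ?_)
      simp only [Pi.add_apply]
      ring
  · intro i _
    simpa using hint (∂_{EuclideanSpace.single i (1 : ℝ)} (∂_{EuclideanSpace.single i (1 : ℝ)} φ))
      i 0 (z + 2) (by simp; linarith)

/-- The integral `∫ |x|^z f(x) dx` over `ℝ^n`. -/
noncomputable def normCpowIntegral {n : ℕ} (f : EuclideanSpace ℝ (Fin n) → ℂ) (z : ℂ) : ℂ :=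
  ∫ x : EuclideanSpace ℝ (Fin n), (‖x‖ : ℂ) ^ z * f x

theorem isOpen_lt_re (c : ℝ) : IsOpen {z : ℂ | c < z.re} :=
  isOpen_lt continuous_const Complex.continuous_re

theorem eqOn_halfPlane_of_eqOn {f g : ℂ → ℂ} {c b : ℝ}
    (hf : DifferentiableOn ℂ f {z | c < z.re}) (hg : DifferentiableOn ℂ g {z | c < z.re})
    (h : ∀ z : ℂ, b < z.re → f z = g z) : Set.EqOn f g {z | c < z.re} := by
  have hz0 : max b c < ((max b c + 1 : ℝ) : ℂ).re := by simp
  refine (hf.analyticOnNhd (isOpen_lt_re c)).eqOn_of_preconnected_of_eventuallyEq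
    (hg.analyticOnNhd (isOpen_lt_re c)) (convex_halfSpace_re_gt c).isPreconnected
    (lt_of_le_of_lt (le_max_right b c) hz0) ?_
  filter_upwards [(isOpen_lt_re b).mem_nhds (lt_of_le_of_lt (le_max_left b c) hz0)] with z hz
  exact h z hz

theorem SchwartzMap.differentiableOn_normCpowIntegral {n : ℕ} (hn : 1 ≤ n)
    (φ : SchwartzMap (EuclideanSpace ℝ (Fin n)) ℂ) :
    DifferentiableOn ℂ (normCpowIntegral φ) {z | -(n : ℝ) < z.re} := fun z hz =>
  (differentiableAt_integral_cpow_radial hn φ.continuous.aestronglyMeasurable 0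
    φ.norm_pow_mul_le (by simpa using hz)).differentiableWithinAt

theorem normCpowIntegral_laplacian {n : ℕ} (hn : 1 ≤ n)
    (φ : SchwartzMap (EuclideanSpace ℝ (Fin n)) ℂ) {z : ℂ} (hz : -(n : ℝ) < z.re) :
    normCpowIntegral (Δ φ : SchwartzMap (EuclideanSpace ℝ (Fin n)) ℂ) (z + 2) =
      (z + 2) * (z + n) * normCpowIntegral φ z := by
  refine eqOn_halfPlane_of_eqOn (b := 1)
    (f := fun z => normCpowIntegral (Δ φ : SchwartzMap (EuclideanSpace ℝ (Fin n)) ℂ) (z + 2))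
    (g := fun z => (z + 2) * (z + n) * normCpowIntegral φ z) ?_ ?_
    (fun w hw => integral_norm_cpow_mul_laplacian_of_one_lt hn φ hw) hz
  · refine (SchwartzMap.differentiableOn_normCpowIntegral hn _).comp (by fun_prop) fun w hw => ?_
    simp only [Set.mem_ofPred_eq, Complex.add_re, Complex.re_ofNat] at hw ⊢
    linarith
  · exact DifferentiableOn.mul (by fun_prop) (φ.differentiableOn_normCpowIntegral hn)

theorem normalized_normCpowIntegral_laplacian {n : ℕ} (hn : 1 ≤ n)
    (φ : SchwartzMap (EuclideanSpace ℝ (Fin n)) ℂ) {z : ℂ} (hz : -(n : ℝ) < z.re) :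
    normCpowIntegral (Δ φ : SchwartzMap (EuclideanSpace ℝ (Fin n)) ℂ) (z + 2) *
        (Complex.Gamma ((z + 2 + n) / 2))⁻¹ =
      2 * (z + 2) * (normCpowIntegral φ z * (Complex.Gamma ((z + n) / 2))⁻¹) := by
  rw [normCpowIntegral_laplacian hn φ hz,
    Complex.one_div_Gamma_eq_self_mul_one_div_Gamma_add_one ((z + n) / 2),
    show (z + n) / 2 + 1 = (z + 2 + n) / 2 by ring]
  ring

theorem exists_normalized_continuation_halfPlane {n : ℕ} (hn : 1 ≤ n) (k : ℕ) :
    ∀ φ : SchwartzMap (EuclideanSpace ℝ (Fin n)) ℂ, ∃ H : ℂ → ℂ,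
      DifferentiableOn ℂ H {z | -(n : ℝ) - 2 * k < z.re} ∧
      ∀ z : ℂ, -(n : ℝ) < z.re → H z = normCpowIntegral φ z * (Complex.Gamma ((z + n) / 2))⁻¹ := by
  have hn' : (1 : ℝ) ≤ n := by exact_mod_cast hn
  have hbase (φ : SchwartzMap (EuclideanSpace ℝ (Fin n)) ℂ) : DifferentiableOn ℂ
      (fun z => normCpowIntegral φ z * (Complex.Gamma ((z + n) / 2))⁻¹) {z | -(n : ℝ) < z.re} :=
    (φ.differentiableOn_normCpowIntegral hn).mul
      (Complex.differentiable_one_div_Gamma.comp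
        (by fun_prop : Differentiable ℂ fun z : ℂ => (z + n) / 2)).differentiableOn
  induction k with
  | zero => exact fun φ => ⟨_, by simpa using hbase φ, fun z _ => rfl⟩
  | succ k ih =>
    intro φ
    obtain ⟨K, hK, hKeq⟩ := ih (Δ φ)
    have hK2 : DifferentiableOn ℂ (fun z => K (z + 2))
        {z | -(n : ℝ) - 2 * (k + 1 : ℕ) < z.re} := by
      refine hK.comp (by fun_prop) fun w hw => ?_
      simp only [Set.mem_ofPred_eq, Complex.add_re, Complex.re_ofNat, Nat.cast_add, Nat.cast_one]
        at hw ⊢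
      linarith
    have hzero : K (-2 + 2) = 0 := by
      rw [hKeq _ (by norm_num; linarith)]
      simp [normCpowIntegral, integral_laplacian_eq_zero]
    have hmem : (-2 : ℂ) ∈ {z : ℂ | -(n : ℝ) - 2 * (k + 1 : ℕ) < z.re} := by
      simp
      linarith
    have hH : DifferentiableOn ℂ (fun z => dslope (fun z => K (z + 2)) (-2) z / 2)
        {z | -(n : ℝ) - 2 * (k + 1 : ℕ) < z.re} :=
      ((Complex.differentiableOn_dslope ((isOpen_lt_re _).mem_nhds hmem)).2 hK2).div_const 2
    refine ⟨_, hH, fun z hz => ?_⟩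
    have hne : ∀ w : ℂ, -(n : ℝ) < w.re → w ≠ -2 →
        dslope (fun z => K (z + 2)) (-2) w / 2 =
          normCpowIntegral φ w * (Complex.Gamma ((w + n) / 2))⁻¹ := by
      intro w hw hw2
      have hw2' : w + 2 ≠ 0 := fun h => hw2 (eq_neg_of_add_eq_zero_left h)
      rw [dslope_of_ne _ hw2, slope_def_field, hzero, sub_zero, sub_neg_eq_add,
        hKeq _ (by simp; linarith), normalized_normCpowIntegral_laplacian hn φ hw]
      field_simp
    refine eqOn_halfPlane_of_eqOn (b := 0) (hH.mono fun w hw => ?_) (hbase φ)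
      (fun w hw => hne w (by linarith) ?_) hz
    · simp only [Set.mem_ofPred_eq, Nat.cast_add, Nat.cast_one] at hw ⊢
      have : (0 : ℝ) ≤ k := k.cast_nonneg
      linarith
    · rintro rfl
      norm_num at hw

theorem exists_normalized_continuation {n : ℕ} (hn : 1 ≤ n)
    (φ : SchwartzMap (EuclideanSpace ℝ (Fin n)) ℂ) : ∃ H : ℂ → ℂ, Differentiable ℂ H ∧
      ∀ z : ℂ, -(n : ℝ) < z.re →
        H z = normCpowIntegral φ z * (Complex.Gamma ((z + n) / 2))⁻¹ := by
  choose H hd heq using fun k => exists_normalized_continuation_halfPlane hn k φ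
  have hcompat : ∀ k l : ℕ, k ≤ l → ∀ z : ℂ, -(n : ℝ) - 2 * k < z.re → H k z = H l z := by
    intro k l hkl z hz
    have hkl' : (k : ℝ) ≤ l := by exact_mod_cast hkl
    refine eqOn_halfPlane_of_eqOn (b := -(n : ℝ)) (hd k) ((hd l).mono fun w hw => ?_)
      (fun w hw => (heq k w hw).trans (heq l w hw).symm) hz
    simp only [Set.mem_ofPred_eq] at hw ⊢
    linarith
  have hlt : ∀ z : ℂ, -(n : ℝ) - 2 * (⌈|z.re|⌉₊ : ℕ) < z.re := by
    intro z
    have h1 := Nat.le_ceil |z.re|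
    have h2 := neg_abs_le z.re
    have h3 : (1 : ℝ) ≤ n := by exact_mod_cast hn
    have h4 := abs_nonneg z.re
    linarith
  have hloc : ∀ (k : ℕ) (z : ℂ), -(n : ℝ) - 2 * k < z.re → H ⌈|z.re|⌉₊ z = H k z := by
    intro k z hz
    rcases le_total k ⌈|z.re|⌉₊ with h | h
    · exact (hcompat _ _ h z hz).symm
    · exact hcompat _ _ h z (hlt z)
  refine ⟨fun z => H ⌈|z.re|⌉₊ z, fun z => ?_, fun z hz => heq _ z hz⟩
  have hnhds := (isOpen_lt_re (-(n : ℝ) - 2 * (⌈|z.re|⌉₊ : ℕ))).mem_nhds (hlt z)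
  refine ((hd ⌈|z.re|⌉₊).differentiableAt hnhds).congr_of_eventuallyEq ?_
  filter_upwards [hnhds] with w hw
  exact hloc _ w hw

theorem normalized_continuation_laplacian {n : ℕ} (hn : 1 ≤ n)
    (φ : SchwartzMap (EuclideanSpace ℝ (Fin n)) ℂ) {H K : ℂ → ℂ} (hH : Differentiable ℂ H)
    (hHeq : ∀ z : ℂ, -(n : ℝ) < z.re →
      H z = normCpowIntegral φ z * (Complex.Gamma ((z + n) / 2))⁻¹)
    (hK : Differentiable ℂ K)
    (hKeq : ∀ z : ℂ, -(n : ℝ) < z.re →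
      K z = normCpowIntegral (Δ φ : SchwartzMap (EuclideanSpace ℝ (Fin n)) ℂ) z *
        (Complex.Gamma ((z + n) / 2))⁻¹) (z : ℂ) :
    K (z + 2) = 2 * (z + 2) * H z := by
  refine eqOn_halfPlane_of_eqOn (c := z.re - 1) (b := -(n : ℝ)) (f := fun z => K (z + 2))
    (g := fun z => 2 * (z + 2) * H z) (by fun_prop) (by fun_prop) (fun w hw => ?_) (by simp)
  rw [hKeq _ (by simp; linarith), hHeq _ hw, normalized_normCpowIntegral_laplacian hn φ hw]

theorem normCpowIntegral_gaussian {n : ℕ} (hn : 1 ≤ n) {s : ℝ} (hs : -(n : ℝ) < s) :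
    normCpowIntegral (fun x : EuclideanSpace ℝ (Fin n) => ((Real.exp (-‖x‖ ^ 2) : ℝ) : ℂ)) s =
      ((√Real.pi ^ n / Real.Gamma (n / 2) * Real.Gamma ((s + n) / 2) : ℝ) : ℂ) := by
  have : Nonempty (Fin n) := ⟨⟨0, hn⟩⟩
  have hn0 : (0 : ℝ) < n := by exact_mod_cast hn
  have h1 : ∀ x : EuclideanSpace ℝ (Fin n), (‖x‖ : ℂ) ^ (s : ℂ) *
      ((Real.exp (-‖x‖ ^ 2) : ℝ) : ℂ) = ((‖x‖ ^ s * Real.exp (-‖x‖ ^ 2) : ℝ) : ℂ) := by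
    intro x
    rw [Complex.ofReal_mul, Complex.ofReal_cpow (norm_nonneg x)]
  have hvol : volume.real (Metric.ball (0 : EuclideanSpace ℝ (Fin n)) 1) =
      √Real.pi ^ n / Real.Gamma (n / 2 + 1) := by
    rw [measureReal_def, EuclideanSpace.volume_ball, Fintype.card_fin, ENNReal.ofReal_one, one_pow,
      one_mul, ENNReal.toReal_ofReal]
    have := Real.Gamma_pos_of_pos (by positivity : (0 : ℝ) < n / 2 + 1)
    positivity
  have hrad : ∫ r in Set.Ioi (0 : ℝ), r ^ (n - 1) • (r ^ s * Real.exp (-r ^ 2)) =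
      1 / 2 * Real.Gamma ((s + n) / 2) := by
    have h2 := integral_rpow_mul_exp_neg_rpow (p := 2) (q := s + n - 1) two_pos (by linarith)
    rw [show s + n - 1 + 1 = s + n by ring] at h2
    rw [← h2]
    refine setIntegral_congr_fun measurableSet_Ioi fun r hr => ?_
    have hr' : (0 : ℝ) < r := hr
    simp only [smul_eq_mul]
    rw [← mul_assoc, ← Real.rpow_natCast r (n - 1), ← Real.rpow_add hr', Nat.cast_sub hn,
      Real.rpow_two]
    congr 2
    push_cast
    ring
  unfold normCpowIntegral
  simp only [h1]
  rw [integral_complex_ofReal,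
    integral_fun_norm_addHaar volume (fun r : ℝ => r ^ s * Real.exp (-r ^ 2)),
    finrank_euclideanSpace_fin, hrad, hvol, Real.Gamma_add_one (by positivity)]
  have := (Real.Gamma_pos_of_pos (by positivity : (0 : ℝ) < n / 2)).ne'
  congr 1
  simp only [smul_eq_mul, nsmul_eq_mul]
  field_simp

theorem pow_mul_exp_neg_sq_le {r : ℝ} (k : ℕ) :
    r ^ k * Real.exp (-r ^ 2) ≤ 1 + k.factorial := by
  have h1 : Real.exp (-r ^ 2) ≤ 1 := Real.exp_le_one_iff.2 (by nlinarith)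
  have h2 := Real.pow_div_factorial_le_exp (r ^ 2) (by positivity) k
  rw [div_le_iff₀ (by positivity)] at h2
  have h3 : r ^ k ≤ 1 + (r ^ 2) ^ k := by
    rw [← pow_mul, mul_comm, pow_mul]
    nlinarith [sq_nonneg (r ^ k - 1)]
  have h4 : Real.exp (r ^ 2) * Real.exp (-r ^ 2) = 1 := by
    rw [← Real.exp_add]
    simp
  calc r ^ k * Real.exp (-r ^ 2) ≤ (1 + Real.exp (r ^ 2) * k.factorial) * Real.exp (-r ^ 2) := by
        gcongr
        linarith
    _ = Real.exp (-r ^ 2) + (Real.exp (r ^ 2) * Real.exp (-r ^ 2)) * k.factorial := by ring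
    _ ≤ _ := by rw [h4, one_mul]; gcongr

theorem SchwartzMap.norm_pow_mul_sub_gaussian_le {n : ℕ}
    (φ : SchwartzMap (EuclideanSpace ℝ (Fin n)) ℂ) (k : ℕ) :
    ∃ C : ℝ, ∀ x, ‖x‖ ^ k * ‖φ x - φ 0 * ((Real.exp (-‖x‖ ^ 2) : ℝ) : ℂ)‖ ≤ C * ‖x‖ ^ 1 := by
  cases k with
  | zero =>
    obtain ⟨C, -, hC⟩ := φ.decay 0 1
    refine ⟨C + ‖φ 0‖, fun x => ?_⟩
    have h1 : ‖φ x - φ 0‖ ≤ C * ‖x - 0‖ :=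
      convex_univ.norm_image_sub_le_of_norm_fderiv_le (𝕜 := ℝ)
        (fun y _ => φ.differentiableAt) (fun y _ => by simpa using hC y)
        (Set.mem_univ _) (Set.mem_univ _)
    have h2 : ‖φ 0 * (1 - ((Real.exp (-‖x‖ ^ 2) : ℝ) : ℂ))‖ ≤ ‖φ 0‖ * ‖x‖ := by
      rw [norm_mul, ← Complex.ofReal_one, ← Complex.ofReal_sub, Complex.norm_real]
      gcongr
      have h3 : Real.exp (-‖x‖ ^ 2) ≤ 1 := Real.exp_le_one_iff.2 (by nlinarith)
      have h4 := Real.add_one_le_exp (-‖x‖ ^ 2)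
      have h5 := Real.exp_pos (-‖x‖ ^ 2)
      rw [Real.norm_of_nonneg (by linarith)]
      rcases le_total ‖x‖ 1 with h | h
      · nlinarith [norm_nonneg x]
      · linarith
    calc ‖x‖ ^ 0 * ‖φ x - φ 0 * ((Real.exp (-‖x‖ ^ 2) : ℝ) : ℂ)‖
        = ‖(φ x - φ 0) + φ 0 * (1 - ((Real.exp (-‖x‖ ^ 2) : ℝ) : ℂ))‖ := by
          rw [pow_zero, one_mul]
          congr 1
          ring
      _ ≤ C * ‖x - 0‖ + ‖φ 0‖ * ‖x‖ := (norm_add_le _ _).trans (add_le_add h1 h2)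
      _ = _ := by rw [sub_zero]; ring
  | succ k =>
    obtain ⟨C, hC⟩ := φ.norm_pow_mul_le k
    refine ⟨C + ‖φ 0‖ * (1 + k.factorial), fun x => ?_⟩
    rw [pow_succ, mul_right_comm, pow_one]
    gcongr
    calc ‖x‖ ^ k * ‖φ x - φ 0 * ((Real.exp (-‖x‖ ^ 2) : ℝ) : ℂ)‖
        ≤ ‖x‖ ^ k * (‖φ x‖ + ‖φ 0 * ((Real.exp (-‖x‖ ^ 2) : ℝ) : ℂ)‖) := by
          gcongr
          exact norm_sub_le _ _
      _ = ‖x‖ ^ k * ‖φ x‖ + ‖φ 0‖ * (‖x‖ ^ k * Real.exp (-‖x‖ ^ 2)) := by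
          rw [norm_mul, Complex.norm_real, Real.norm_of_nonneg (Real.exp_pos _).le]
          ring
      _ ≤ C + ‖φ 0‖ * (1 + k.factorial) := by
          gcongr
          · simpa using hC x
          · exact pow_mul_exp_neg_sq_le k

theorem normalized_continuation_neg_dim {n : ℕ} (hn : 1 ≤ n)
    (φ : SchwartzMap (EuclideanSpace ℝ (Fin n)) ℂ) {H : ℂ → ℂ} (hH : Differentiable ℂ H)
    (hHeq : ∀ z : ℂ, -(n : ℝ) < z.re →
      H z = normCpowIntegral φ z * (Complex.Gamma ((z + n) / 2))⁻¹) :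
    H (-n) = ((√Real.pi ^ n / Real.Gamma (n / 2) : ℝ) : ℂ) * φ 0 := by
  set g : EuclideanSpace ℝ (Fin n) → ℂ := fun x => ((Real.exp (-‖x‖ ^ 2) : ℝ) : ℂ) with hg
  set ψ : EuclideanSpace ℝ (Fin n) → ℂ := fun x => φ x - φ 0 * g x with hψ
  have hgc : Continuous g := by fun_prop
  have hψm : AEStronglyMeasurable ψ :=
    (φ.continuous.sub (continuous_const.mul hgc)).aestronglyMeasurable
  have hgb (k : ℕ) : ∃ C : ℝ, ∀ x, ‖x‖ ^ k * ‖g x‖ ≤ C * ‖x‖ ^ 0 :=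
    ⟨1 + k.factorial, fun x => by
      change ‖x‖ ^ k * ‖((Real.exp (-‖x‖ ^ 2) : ℝ) : ℂ)‖ ≤ _
      rw [pow_zero, mul_one, Complex.norm_real, Real.norm_of_nonneg (Real.exp_pos _).le]
      exact pow_mul_exp_neg_sq_le k⟩
  have hcont : ContinuousAt (normCpowIntegral ψ) (-n) :=
    (differentiableAt_integral_cpow_radial hn hψm 1 φ.norm_pow_mul_sub_gaussian_le
      (by simp)).continuousAt
  have hval : ∀ s : ℝ, -(n : ℝ) < s → H s =
      ((√Real.pi ^ n / Real.Gamma (n / 2) : ℝ) : ℂ) * φ 0 +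
        normCpowIntegral ψ s * (Complex.Gamma ((s + n) / 2))⁻¹ := by
    intro s hs
    have hG : Complex.Gamma ((s + n) / 2) ≠ 0 := Complex.Gamma_ne_zero_of_re_pos (by simp; linarith)
    have hsum : normCpowIntegral φ s = φ 0 * normCpowIntegral g s + normCpowIntegral ψ s := by
      unfold normCpowIntegral
      rw [← integral_const_mul, ← integral_add]
      · congr 1
        ext x
        simp only [hψ]
        ring
      · exact (integrable_cpow_radial_of_bounds hn hgc.aestronglyMeasurable 0 hgb
          (by simpa using hs)).const_mul _
      · exact integrable_cpow_radial_of_bounds hn hψm 1 φ.norm_pow_mul_sub_gaussian_le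
          (by simp; linarith)
    rw [hHeq s (by simpa using hs), hsum, normCpowIntegral_gaussian hn hs, Complex.ofReal_mul,
      ← Complex.Gamma_ofReal ((s + n) / 2)]
    push_cast
    field_simp
  have hofReal : Tendsto (fun s : ℝ => (s : ℂ)) (𝓝[>] (-(n : ℝ))) (𝓝 (-n : ℂ)) := by
    have := (Complex.continuous_ofReal.tendsto (-(n : ℝ))).mono_left
      (nhdsWithin_le_nhds (s := Set.Ioi (-(n : ℝ))))
    simpa using this
  have hGc : ContinuousAt (fun z : ℂ => (Complex.Gamma ((z + n) / 2))⁻¹) (-n) :=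
    (Complex.differentiable_one_div_Gamma.comp
      (by fun_prop : Differentiable ℂ fun z : ℂ => (z + n) / 2)).continuous.continuousAt
  have h1 : Tendsto (fun s : ℝ => H s) (𝓝[>] (-(n : ℝ))) (𝓝 (H (-n))) :=
    (hH.continuous.tendsto _).comp hofReal
  have h2 := (((hcont.tendsto.mul hGc.tendsto).const_add
    (((√Real.pi ^ n / Real.Gamma (n / 2) : ℝ) : ℂ) * φ 0)).comp hofReal)
  have h3 : Tendsto (fun s : ℝ => H s) (𝓝[>] (-(n : ℝ)))
      (𝓝 (((√Real.pi ^ n / Real.Gamma (n / 2) : ℝ) : ℂ) * φ 0)) := by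
    simp only [neg_add_cancel, zero_div, Complex.Gamma_zero, inv_zero, mul_zero, add_zero] at h2
    refine h2.congr' ?_
    filter_upwards [self_mem_nhdsWithin] with s hs
    exact (hval s hs).symm
  exact tendsto_nhds_unique h1 h3

theorem cmn_zero_div_factorial (n : ℕ) :
    cmn 0 n / ((2 * 0).factorial : ℝ) = 2 * (√Real.pi ^ n / Real.Gamma (n / 2)) := by
  have h : √Real.pi * Real.pi ^ (((n : ℝ) - 1) / 2) = √Real.pi ^ n := by
    rw [Real.sqrt_eq_rpow, ← Real.rpow_add Real.pi_pos, ← Real.rpow_mul_natCast Real.pi_pos.le]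
    congr 1
    ring
  simp only [cmn, Nat.cast_zero, zero_add, Real.Gamma_one_half_eq, mul_assoc, h]
  simp [mul_div_assoc]

theorem cmn_succ_div_factorial {n : ℕ} (hn : 1 ≤ n) (m : ℕ) :
    cmn (m + 1) n / ((2 * (m + 1)).factorial : ℝ) =
      cmn m n / ((2 * m).factorial : ℝ) / ((2 * m + 2) * (n + 2 * m)) := by
  have hn0 : (0 : ℝ) < n := by exact_mod_cast hn
  have h1 : Real.Gamma (((m + 1 : ℕ) : ℝ) + 1 / 2) =
      ((m : ℝ) + 1 / 2) * Real.Gamma ((m : ℝ) + 1 / 2) := by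
    rw [← Real.Gamma_add_one (by positivity)]
    congr 1
    push_cast
    ring
  have h2 : Real.Gamma (((m + 1 : ℕ) : ℝ) + (n : ℝ) / 2) =
      ((m : ℝ) + n / 2) * Real.Gamma ((m : ℝ) + n / 2) := by
    rw [← Real.Gamma_add_one (by positivity)]
    congr 1
    push_cast
    ring
  have h3 : ((2 * (m + 1)).factorial : ℝ) = (2 * m + 2) * (2 * m + 1) * (2 * m).factorial := by
    rw [show 2 * (m + 1) = 2 * m + 1 + 1 by ring, Nat.factorial_succ, Nat.factorial_succ]
    push_cast
    ring
  have h4 := (Real.Gamma_pos_of_pos (by positivity : (0 : ℝ) < (m : ℝ) + n / 2)).ne'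
  rw [cmn, cmn, h1, h2, h3]
  field_simp
  ring

theorem tendsto_mul_Gamma_mul_continuation {n : ℕ} (hn : 1 ≤ n) (m : ℕ) :
    ∀ (φ : SchwartzMap (EuclideanSpace ℝ (Fin n)) ℂ) (H : ℂ → ℂ), Differentiable ℂ H →
      (∀ z : ℂ, -(n : ℝ) < z.re →
        H z = normCpowIntegral φ z * (Complex.Gamma ((z + n) / 2))⁻¹) →
      Tendsto (fun z : ℂ => (z + n + 2 * m) * (Complex.Gamma ((z + n) / 2) * H z))
        (𝓝[≠] (-(n : ℂ) - 2 * m))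
        (𝓝 (((cmn m n / ((2 * m).factorial : ℝ) : ℝ) : ℂ) * (lap^[m] ⇑φ) 0)) := by
  induction m with
  | zero =>
    intro φ H hH hHeq
    have h1 : Tendsto (fun z : ℂ => (z + n) / 2) (𝓝[≠] (-(n : ℂ))) (𝓝[≠] 0) := by
      refine tendsto_nhdsWithin_iff.2 ⟨?_, ?_⟩
      · have : ContinuousAt (fun z : ℂ => (z + n) / 2) (-(n : ℂ)) := by fun_prop
        simpa using this.tendsto.mono_left nhdsWithin_le_nhds
      · filter_upwards [self_mem_nhdsWithin] with z hz
        have hz' : z ≠ -n := hz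
        simpa [add_eq_zero_iff_eq_neg] using hz'
    have h2 := ((Complex.tendsto_self_mul_Gamma_nhds_zero.comp h1).const_mul 2).mul
      ((hH.continuous.tendsto (-(n : ℂ))).mono_left (nhdsWithin_le_nhds (s := {-(n : ℂ)}ᶜ)))
    rw [normalized_continuation_neg_dim hn φ hH hHeq] at h2
    rw [cmn_zero_div_factorial]
    simp only [Nat.cast_zero, mul_zero, sub_zero, add_zero, Function.iterate_zero, id]
    convert! h2 using 2
    · simp only [Function.comp]
      ring
    · push_cast
      ring
  | succ m ih =>
    intro φ H hH hHeq
    obtain ⟨K, hK, hKeq⟩ := exists_normalized_continuation hn (Δ φ)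
    have hHK := normalized_continuation_laplacian hn φ hH hHeq hK hKeq
    have hn0 : (0 : ℝ) < n := by exact_mod_cast hn
    have hA : (-(n : ℂ) - 2 * (m + 1 : ℕ) + 2) ≠ 0 := by
      intro h
      have := congrArg Complex.re h
      simp at this
      linarith [(Nat.cast_nonneg m : (0 : ℝ) ≤ m)]
    have hB : (-(n : ℂ) - 2 * (m + 1 : ℕ) + n) ≠ 0 := by
      intro h
      have := congrArg Complex.re h
      simp at this
      linarith [(Nat.cast_nonneg m : (0 : ℝ) ≤ m)]
    have h1 : Tendsto (fun z : ℂ => z + 2) (𝓝[≠] (-(n : ℂ) - 2 * (m + 1 : ℕ)))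
        (𝓝[≠] (-(n : ℂ) - 2 * m)) := by
      refine tendsto_nhdsWithin_iff.2 ⟨?_, ?_⟩
      · have : ContinuousAt (fun z : ℂ => z + 2) (-(n : ℂ) - 2 * (m + 1 : ℕ)) := by fun_prop
        convert this.tendsto.mono_left nhdsWithin_le_nhds using 2
        push_cast
        ring
      · filter_upwards [self_mem_nhdsWithin] with z hz h
        refine hz (Set.mem_singleton_iff.2 ?_)
        have h' : z + 2 = -(n : ℂ) - 2 * m := h
        push_cast
        linear_combination h'
    have hc : ContinuousAt (fun z : ℂ => ((z + 2) * (z + n))⁻¹) (-(n : ℂ) - 2 * (m + 1 : ℕ)) :=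
      ContinuousAt.inv₀ (by fun_prop) (mul_ne_zero hA hB)
    have h2 := ((ih (Δ φ) K hK hKeq).comp h1).mul (hc.tendsto.mono_left
      (nhdsWithin_le_nhds (s := ({-(n : ℂ) - 2 * ((m + 1 : ℕ) : ℂ)}ᶜ : Set ℂ))))
    have hcA : ContinuousAt (fun z : ℂ => z + 2) (-(n : ℂ) - 2 * (m + 1 : ℕ)) := by fun_prop
    have hcB : ContinuousAt (fun z : ℂ => z + (n : ℂ)) (-(n : ℂ) - 2 * (m + 1 : ℕ)) := by fun_prop
    have hev : ∀ᶠ z : ℂ in 𝓝[≠] (-(n : ℂ) - 2 * (m + 1 : ℕ)), z + 2 ≠ 0 ∧ z + n ≠ 0 :=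
      ((hcA.eventually_ne hA).and (hcB.eventually_ne hB)).filter_mono nhdsWithin_le_nhds
    rw [cmn_succ_div_factorial hn, Function.iterate_succ_apply, ← SchwartzMap.coe_laplacian_eq_lap]
    have hlim : ((cmn m n / ((2 * m).factorial : ℝ) : ℝ) : ℂ) *
        (lap^[m] ⇑(Δ φ : SchwartzMap (EuclideanSpace ℝ (Fin n)) ℂ)) 0 *
          ((-(n : ℂ) - 2 * (m + 1 : ℕ) + 2) * (-(n : ℂ) - 2 * (m + 1 : ℕ) + n))⁻¹ =
        ((cmn m n / ((2 * m).factorial : ℝ) / ((2 * m + 2) * (n + 2 * m)) : ℝ) : ℂ) *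
        (lap^[m] ⇑(Δ φ : SchwartzMap (EuclideanSpace ℝ (Fin n)) ℂ)) 0 := by
      rw [show (-(n : ℂ) - 2 * (m + 1 : ℕ) + 2) * (-(n : ℂ) - 2 * (m + 1 : ℕ) + n) =
        (2 * m + 2) * (n + 2 * m) by push_cast; ring]
      push_cast
      ring
    rw [← hlim]
    refine h2.congr' ?_
    filter_upwards [hev] with z ⟨hz1, hz2⟩
    simp only [Function.comp]
    rw [hHK z, show (z + 2 + n) / 2 = (z + n) / 2 + 1 by ring,
      Complex.Gamma_add_one _ (div_ne_zero hz2 two_ne_zero)]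
    push_cast
    field_simp
    ring

/-- **Meromorphic continuation of `λ ↦ ⟨r^λ, φ⟩` for a Schwartz function `φ`.**
There is `F` holomorphic on `ℂ ∖ {-n-2m : m ∈ ℕ}` with
`F(λ) = ∫ |x|^λ φ(x) dx` for `Re λ > -n` (absolutely convergent), and at each
`λ = -n-2m` `F` has at worst a simple pole with
`lim (λ+n+2m) F(λ) = (c_{m,n}/(2m)!) (Δ^m φ)(0)`.  In particular there are no
singularities at the points `-n-(2m+1)`. -/
theorem mellin_norm_pow_analytic (n : ℕ) (hn : 1 ≤ n)
    (φ : SchwartzMap (EuclideanSpace ℝ (Fin n)) ℂ) :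
    ∃ F : ℂ → ℂ,
      DifferentiableOn ℂ F {lam : ℂ | ∀ m : ℕ, lam ≠ -(n : ℂ) - 2 * m} ∧
      (∀ lam : ℂ, -(n : ℝ) < lam.re →
        Integrable (fun x : EuclideanSpace ℝ (Fin n) => (‖x‖ : ℂ) ^ lam * φ x) ∧
        F lam = ∫ x : EuclideanSpace ℝ (Fin n), (‖x‖ : ℂ) ^ lam * φ x) ∧
      ∀ m : ℕ,
        Tendsto (fun lam : ℂ => (lam + n + 2 * m) * F lam)
          (𝓝[≠] (-(n : ℂ) - 2 * m))
          (𝓝 (((cmn m n / ((2 * m).factorial : ℝ) : ℝ) : ℂ) * (lap^[m] ⇑φ) 0)) := by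
  obtain ⟨H, hH, hHeq⟩ := exists_normalized_continuation hn φ
  refine ⟨fun z => Complex.Gamma ((z + n) / 2) * H z, fun z hz => ?_, fun z hz => ⟨?_, ?_⟩,
    fun m => tendsto_mul_Gamma_mul_continuation hn m φ H hH hHeq⟩
  · have hG : DifferentiableAt ℂ Complex.Gamma ((z + n) / 2) := by
      refine Complex.differentiableAt_Gamma _ fun m hm => hz m ?_
      linear_combination 2 * hm
    have hl : DifferentiableAt ℂ (fun z : ℂ => (z + n) / 2) z := by fun_prop
    exact ((hG.comp z hl).mul hH.differentiableAt).differentiableWithinAt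
  · exact integrable_cpow_radial_of_bounds hn φ.continuous.aestronglyMeasurable 0
      φ.norm_pow_mul_le (by simpa using hz)
  · have hG : Complex.Gamma ((z + n) / 2) ≠ 0 := Complex.Gamma_ne_zero_of_re_pos (by simp; linarith)
    change Complex.Gamma ((z + n) / 2) * H z = normCpowIntegral φ z
    rw [hHeq z hz, mul_comm, inv_mul_cancel_right₀ hG]
end
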